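/- For every s with 0 < s ≤ 1/4, one has s · θₒ'(s)/θₒ(s) ≥ θₒ'(1)/θₒ(1). -/

import Mathlib

noncomputable def thetaO (s : ℝ) : ℝ := ∑' k : ℤ, Real.exp (-Real.pi * (2 * (k : ℝ) + 1) ^ 2 * s)

noncomputable def aO (s : ℝ) (n : ℕ) : ℝ := Real.exp (-Real.pi * (2 * (n : ℝ) + 1) ^ 2 * s)

lemma aO_pos (s : ℝ) (n : ℕ) : 0 < aO s n := Real.exp_pos _

lemma aO_summable {s : ℝ} (hs : 0 < s) : Summable (aO s) := by
  have h : Summable (fun n : ℕ => Real.exp ((n : ℝ) * (-(Real.pi * s)))) :=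
    Real.summable_exp_nat_mul_iff.mpr (by have := mul_pos Real.pi_pos hs; linarith)
  refine Summable.of_nonneg_of_le (fun n => (aO_pos s n).le) (fun n => ?_) h
  unfold aO
  apply Real.exp_le_exp.mpr
  have h1 := mul_pos Real.pi_pos hs
  have hn : (0 : ℝ) ≤ n := Nat.cast_nonneg n
  have h2 : (n : ℝ) ≤ (2 * (n : ℝ) + 1) ^ 2 := by nlinarith
  nlinarith [mul_le_mul_of_nonneg_left h2 h1.le]

lemma thetaO_eq {s : ℝ} (hs : 0 < s) : thetaO s = 2 * ∑' n, aO s n := by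
  have h := (aO_summable hs).hasSum
  have h2 : HasSum (fun k : ℤ => Real.exp (-Real.pi * (2 * (k : ℝ) + 1) ^ 2 * s))
      ((∑' n, aO s n) + ∑' n, aO s n) := by
    apply HasSum.of_nat_of_neg_add_one
    · convert h using 2 with n
      unfold aO
      push_cast
      rfl
    · convert h using 2 with n
      unfold aO
      congr 1
      push_cast
      ring
  unfold thetaO
  rw [h2.tsum_eq]; ring

lemma key_exp (y : ℝ) : y * Real.exp (-y) ≤ 4 / 3 * (Real.exp (-(y / 4)) - Real.exp (-y)) := by
  have h : Real.exp (-(y / 4)) = Real.exp (-y) * Real.exp (3 * y / 4) := by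
    rw [← Real.exp_add]; congr 1; ring
  have h2 := Real.add_one_le_exp (3 * y / 4)
  have h3 := Real.exp_pos (-y)
  rw [h]
  nlinarith [mul_le_mul_of_nonneg_left h2 h3.le]

lemma term_bound {s : ℝ} (hs : 0 < s) (n : ℕ) :
    Real.pi * (2 * (n : ℝ) + 1) ^ 2 * aO s n ≤ (4 / 3 / s) * (aO (s / 4) n - aO s n) := by
  have h := key_exp (Real.pi * (2 * (n : ℝ) + 1) ^ 2 * s)
  have e1 : Real.exp (-(Real.pi * (2 * (n : ℝ) + 1) ^ 2 * s)) = aO s n := by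
    unfold aO; congr 1; ring
  have e2 : Real.exp (-(Real.pi * (2 * (n : ℝ) + 1) ^ 2 * s / 4)) = aO (s / 4) n := by
    unfold aO; congr 1; ring
  rw [e1, e2] at h
  rw [div_mul_eq_mul_div, le_div_iff₀ hs]
  linarith

lemma dO_summable {s : ℝ} (hs : 0 < s) :
    Summable (fun n : ℕ => Real.pi * (2 * (n : ℝ) + 1) ^ 2 * aO s n) := by
  refine Summable.of_nonneg_of_le (fun n => ?_) (fun n => term_bound hs n) ?_
  · have := aO_pos s n
    have := Real.pi_pos
    positivity
  · exact ((aO_summable (by positivity)).sub (aO_summable hs)).mul_left _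

lemma deriv_thetaO {s : ℝ} (hs : 0 < s) :
    deriv thetaO s = -2 * ∑' n : ℕ, Real.pi * (2 * (n : ℝ) + 1) ^ 2 * aO s n := by
  have hd : HasDerivAt (fun t => ∑' n, aO t n)
      (∑' n : ℕ, -(Real.pi * (2 * (n : ℝ) + 1) ^ 2 * aO s n)) s := by
    refine hasDerivAt_tsum_of_isPreconnected (t := Set.Ioi (s / 2)) (y₀ := s)
      (g := fun n t => aO t n)
      (g' := fun n t => -(Real.pi * (2 * (n : ℝ) + 1) ^ 2 * aO t n))
      (dO_summable (half_pos hs)) isOpen_Ioi isPreconnected_Ioi ?_ ?_ ?_ ?_ ?_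
    · intro n t _
      unfold aO
      have := ((hasDerivAt_id t).const_mul (-Real.pi * (2 * (n : ℝ) + 1) ^ 2)).exp
      refine this.congr_deriv ?_
      simp only [id, mul_one]
      ring
    · intro n t ht
      have hp := aO_pos t n
      have hpi := Real.pi_pos
      rw [norm_neg, Real.norm_of_nonneg (by positivity)]
      apply mul_le_mul_of_nonneg_left _ (by positivity)
      unfold aO
      apply Real.exp_le_exp.mpr
      have ht' : s / 2 < t := ht
      have : 0 ≤ Real.pi * (2 * (n : ℝ) + 1) ^ 2 := by positivity
      nlinarith [mul_le_mul_of_nonneg_left ht'.le this]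
    · exact Set.mem_Ioi.mpr (by linarith)
    · exact aO_summable hs
    · exact Set.mem_Ioi.mpr (by linarith)
  have he : thetaO =ᶠ[nhds s] fun t => 2 * ∑' n, aO t n := by
    filter_upwards [lt_mem_nhds hs] with t ht using thetaO_eq ht
  rw [he.deriv_eq, (hd.const_mul 2).deriv, tsum_neg]
  ring

lemma quarter_bound {s : ℝ} (hs : 0 < s) (hs' : s ≤ 1 / 4) :
    ∑' n, aO (s / 4) n ≤ 3 * ∑' n, aO s n := by
  have hb := aO_summable (s := s / 4) (by positivity)
  have ha := aO_summable hs
  have hps := mul_pos Real.pi_pos hs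
  have hb1 : Summable (fun n => aO (s / 4) (n + 1)) := (summable_nat_add_iff 1).mpr hb
  have he : Summable (fun n => aO (s / 4) (2 * n + 1)) :=
    hb1.comp_injective (i := fun n => 2 * n) (fun a b h => by simpa using h)
  have ho : Summable (fun n => aO (s / 4) (2 * n + 1 + 1)) :=
    hb1.comp_injective (i := fun n => 2 * n + 1) (fun a b h => by simpa using h)
  have hsplit := tsum_even_add_odd (f := fun n => aO (s / 4) (n + 1)) he ho
  have hc := he.add ho
  have hp : ∀ n, aO (s / 4) (2 * n + 1) + aO (s / 4) (2 * n + 1 + 1) ≤ 2 * aO s n := by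
    intro n
    have hn : (0 : ℝ) ≤ n := Nat.cast_nonneg n
    have h1 : aO (s / 4) (2 * n + 1) ≤ aO s n := by
      unfold aO
      apply Real.exp_le_exp.mpr
      push_cast
      nlinarith [mul_nonneg hps.le hn]
    have h2 : aO (s / 4) (2 * n + 1 + 1) ≤ aO s n := by
      unfold aO
      apply Real.exp_le_exp.mpr
      push_cast
      nlinarith [mul_nonneg hps.le hn]
    linarith
  have h0 : aO (s / 4) 0 + (aO (s / 4) 1 + aO (s / 4) 2) ≤ 3 * aO s 0 := by
    set u := Real.exp (-(3 / 4 * (Real.pi * s))) with hu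
    have hu1 : u ≤ 1 := by
      rw [hu]; apply Real.exp_le_one_iff.mpr; linarith
    have hu0 : 0 < u := Real.exp_pos _
    have hu2 : 1 / 2 ≤ u := by
      rw [hu, ← Real.log_le_iff_le_exp (by norm_num)]
      rw [one_div, Real.log_inv]
      have := Real.log_two_gt_d9
      have := Real.pi_lt_d2
      nlinarith [Real.pi_pos]
    have e0 : aO (s / 4) 0 * u = aO s 0 := by
      rw [hu]; unfold aO; rw [← Real.exp_add]; congr 1; push_cast; ring
    have e1 : aO (s / 4) 1 ≤ aO s 0 * u := by
      rw [hu]; unfold aO; rw [← Real.exp_add]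
      apply Real.exp_le_exp.mpr; push_cast; nlinarith
    have e2 : aO (s / 4) 2 ≤ aO s 0 * u := by
      rw [hu]; unfold aO; rw [← Real.exp_add]
      apply Real.exp_le_exp.mpr; push_cast; nlinarith
    have hb0 := aO_pos (s / 4) 0
    rw [← e0] at e1 e2 ⊢
    have : 0 ≤ (2 * u - 1) * (1 - u) := mul_nonneg (by linarith) (by linarith)
    nlinarith [mul_nonneg hb0.le this]
  rw [hb.tsum_eq_zero_add, ← hsplit, ← he.tsum_add ho, hc.tsum_eq_zero_add, ha.tsum_eq_zero_add]
  have ha1 : Summable (fun n => aO s (n + 1)) := (summable_nat_add_iff 1).mpr ha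
  have hc1 := (summable_nat_add_iff 1).mpr hc
  have hle := hc1.tsum_le_tsum (fun n => hp (n + 1)) (ha1.mul_left 2)
  rw [tsum_mul_left] at hle
  have hnn : 0 ≤ ∑' n, aO s (n + 1) := tsum_nonneg fun n => (aO_pos _ _).le
  simp only [mul_zero, zero_add] at h0 hle ⊢
  linarith

theorem thetaO_log_deriv_lower_bound (s : ℝ) (hs : 0 < s) (hs' : s ≤ 1 / 4) :
    deriv thetaO 1 / thetaO 1 ≤ s * deriv thetaO s / thetaO s := by
  have pos : ∀ t : ℝ, 0 < t → 0 < ∑' n, aO t n := fun t ht =>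
    (aO_summable ht).tsum_pos (fun n => (aO_pos t n).le) 0 (aO_pos t 0)
  have hA : deriv thetaO 1 / thetaO 1 ≤ -Real.pi := by
    have p := pos 1 one_pos
    rw [deriv_thetaO one_pos, thetaO_eq one_pos, div_le_iff₀ (by linarith)]
    have : ∑' n, Real.pi * aO 1 n ≤ ∑' n : ℕ, Real.pi * (2 * (n : ℝ) + 1) ^ 2 * aO 1 n := by
      refine ((aO_summable one_pos).mul_left _).tsum_le_tsum (fun n => ?_) (dO_summable one_pos)
      apply mul_le_mul_of_nonneg_right _ (aO_pos 1 n).le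
      have hn : (0 : ℝ) ≤ n := Nat.cast_nonneg n
      have : (1 : ℝ) ≤ (2 * (n : ℝ) + 1) ^ 2 := by nlinarith
      nlinarith [Real.pi_pos]
    rw [tsum_mul_left] at this
    linarith
  have hB : -Real.pi ≤ s * deriv thetaO s / thetaO s := by
    have p := pos s hs
    have hb := aO_summable (s := s / 4) (by positivity)
    have ha := aO_summable hs
    rw [deriv_thetaO hs, thetaO_eq hs, le_div_iff₀ (by linarith)]
    have h1 := (dO_summable hs).tsum_le_tsum (fun n => term_bound hs n)
      ((hb.sub ha).mul_left _)
    rw [tsum_mul_left, hb.tsum_sub ha, div_mul_eq_mul_div, le_div_iff₀ hs] at h1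
    have h2 := quarter_bound hs hs'
    nlinarith [Real.pi_gt_three]
  exact hA.trans hB
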